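/- arXiv:1611.10140 — 2 statements merged into one kernel-verified Lean document; each statement's English description precedes it below -/
import Mathlib

section
/- For every integer k ≥ 2, the set of integers q such that the complete bipartite graph K_{k,q} has a chromatic root z with Re(z) > k is infinite. (Since the tree-width of K_{k,q} is k for q ≥ k, this gives, for every k ≥ 2, infinitely many graphs of tree-width k with a chromatic root whose real part exceeds k.) -/
/-- `P` is the chromatic polynomial of `G`: for every natural number `k`,
`P` evaluated at `k` equals the number of proper colorings of `G` with `k` colors. -/
def IsChromaticPoly {V : Type*} (G : SimpleGraph V) (P : Polynomial ℂ) : Prop :=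
  ∀ k : ℕ, P.eval (k : ℂ) = Nat.card (G.Coloring (Fin k))

open Filter Topology Metric

/-- If holomorphic functions converge uniformly on a closed disc to a limit that vanishes at the
centre but not on the boundary circle, then they eventually have a zero in the disc. -/
theorem eventually_exists_zero_of_tendstoUniformlyOn {ι : Type*} {l : Filter ι}
    {F : ι → ℂ → ℂ} {g : ℂ → ℂ} {r : ℝ} (hr : 0 < r)
    (hF : ∀ᶠ n in l, DifferentiableOn ℂ (F n) (closedBall 0 r))
    (hlim : TendstoUniformlyOn F g l (closedBall 0 r))
    (hg : ContinuousOn g (sphere 0 r)) (hg0 : g 0 = 0) (hgr : ∀ s ∈ sphere (0 : ℂ) r, g s ≠ 0) :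
    ∀ᶠ n in l, ∃ s ∈ closedBall (0 : ℂ) r, F n s = 0 := by
  obtain ⟨m, hm, hmg⟩ : ∃ m > 0, ∀ s ∈ sphere (0 : ℂ) r, m ≤ ‖g s‖ := by
    obtain ⟨s₀, hs₀, hmin⟩ := (isCompact_sphere (0 : ℂ) r).exists_isMinOn
      (NormedSpace.sphere_nonempty.2 hr.le) hg.norm
    exact ⟨‖g s₀‖, norm_pos_iff.2 (hgr s₀ hs₀), fun s hs => hmin hs⟩
  filter_upwards [hF, Metric.tendstoUniformlyOn_iff.1 hlim (m / 2) (by positivity)] with n hd hn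
  by_contra! hne
  have h0 : (0 : ℂ) ∈ closedBall (0 : ℂ) r := mem_closedBall_self hr.le
  have hcl : closure (ball (0 : ℂ) r) = closedBall 0 r := closure_ball 0 hr.ne'
  have hinv : DiffContOnCl ℂ (fun s => (F n s)⁻¹) (ball 0 r) := by
    apply DifferentiableOn.diffContOnCl
    rw [hcl]
    exact hd.inv hne
  have hle : ‖(F n 0)⁻¹‖ ≤ (m / 2)⁻¹ := by
    refine Complex.norm_le_of_forall_mem_frontier_norm_le isBounded_ball hinv (fun s hs => ?_)
      (hcl ▸ h0)
    rw [frontier_ball 0 hr.ne'] at hs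
    rw [norm_inv]
    refine inv_anti₀ (by positivity) ?_
    have h1 := hn s (sphere_subset_closedBall hs)
    have h2 := hmg s hs
    rw [dist_eq_norm] at h1
    have h3 := norm_sub_norm_le (g s) (F n s)
    linarith
  have h1 := hn 0 h0
  rw [hg0, dist_zero_left] at h1
  rw [norm_inv, inv_le_inv₀ (norm_pos_iff.2 (hne 0 h0)) (by positivity)] at hle
  linarith

/-- If `n x² → 0` and `x → 0`, then `((1 - x) eˣ)ⁿ → 1`. -/
theorem tendsto_one_sub_mul_exp_pow {α : Type*} {l : Filter α} {n : α → ℕ} {x : α → ℂ}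
    (hx : Tendsto x l (𝓝 0)) (hnx : Tendsto (fun a => (n a : ℂ) * x a ^ 2) l (𝓝 0)) :
    Tendsto (fun a => ((1 - x a) * Complex.exp (x a)) ^ n a) l (𝓝 1) := by
  have hsmall : ∀ᶠ a in l, ‖x a‖ < 1 / 2 := by
    have := hx.norm
    rw [norm_zero] at this
    exact this.eventually_lt_const (by norm_num)
  have hexp : Tendsto (fun a => (n a : ℂ) * (Complex.log (1 + -x a) - -x a)) l (𝓝 0) := by
    refine squeeze_zero_norm' ?_ (by simpa using hnx.norm)
    filter_upwards [hsmall] with a ha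
    have h1 := Complex.norm_log_one_add_sub_self_le (z := -x a) (by rw [norm_neg]; linarith)
    rw [norm_neg] at h1
    have h2 : (1 - ‖x a‖)⁻¹ ≤ 2 := by
      rw [inv_le_comm₀ (by linarith) (by norm_num)]
      linarith
    rw [norm_mul, Complex.norm_natCast]
    refine mul_le_mul_of_nonneg_left (h1.trans ?_) (Nat.cast_nonneg _)
    nlinarith [sq_nonneg ‖x a‖]
  have h := (Complex.continuous_exp.tendsto 0).comp hexp
  rw [Complex.exp_zero] at h
  refine h.congr' ?_
  filter_upwards [hsmall] with a ha
  have hne : 1 + -x a ≠ 0 := by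
    intro h0
    have : x a = 1 := by linear_combination -h0
    rw [this, norm_one] at ha
    norm_num at ha
  rw [Function.comp_apply, Complex.exp_nat_mul, sub_neg_eq_add, Complex.exp_add,
    Complex.exp_log hne, ← sub_eq_add_neg]

theorem exists_ne_zero_sum_pow_eq_zero {k : ℕ} (hk : 2 ≤ k) {c : ℕ → ℂ} (h0 : c 0 = 0)
    (h1 : c 1 ≠ 0) (hck : c k ≠ 0) :
    ∃ w : ℂ, w ≠ 0 ∧ ∑ j ∈ Finset.range (k + 1), c j * w ^ j = 0 := by
  let p : Polynomial ℂ := ∑ j ∈ Finset.range k, Polynomial.monomial j (c (j + 1))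
  have hcoeff (m : ℕ) : p.coeff m = if m < k then c (m + 1) else 0 := by
    simp [p, Polynomial.finsetSum_coeff, Polynomial.coeff_monomial]
  have hdeg : p.degree ≠ 0 := by
    intro h
    have := Polynomial.coeff_eq_zero_of_degree_lt (p := p) (n := k - 1)
      (by rw [h]; exact_mod_cast (by omega : 0 < k - 1))
    rw [hcoeff, if_pos (by omega), Nat.sub_add_cancel (by omega)] at this
    exact hck this
  obtain ⟨w, hw⟩ := IsAlgClosed.exists_root p hdeg
  have heval : ∑ j ∈ Finset.range k, c (j + 1) * w ^ j = 0 := by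
    simpa [p, Polynomial.IsRoot, Polynomial.eval_finsetSum] using hw
  refine ⟨w, ?_, ?_⟩
  · rintro rfl
    rw [Polynomial.IsRoot, ← Polynomial.coeff_zero_eq_eval_zero, hcoeff, if_pos (by omega)] at hw
    exact h1 hw
  · rw [Finset.sum_range_succ', h0, zero_mul, add_zero]
    calc _ = w * ∑ j ∈ Finset.range k, c (j + 1) * w ^ j := by
          rw [Finset.mul_sum]
          exact Finset.sum_congr rfl fun j _ => by ring
      _ = 0 := by rw [heval, mul_zero]

/-- A nonzero polynomial precomposed with `s ↦ w eˢ`, `w ≠ 0`, has no zeros on small circles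
about the origin. -/
theorem exists_sphere_sum_exp_pow_ne_zero {k : ℕ} {c : ℕ → ℂ} (hck : c k ≠ 0) {w : ℂ}
    (hw : w ≠ 0) :
    ∃ r > 0, ∀ s ∈ sphere (0 : ℂ) r,
      ∑ j ∈ Finset.range (k + 1), c j * (w * Complex.exp s) ^ j ≠ 0 := by
  let g : ℂ → ℂ := fun s => ∑ j ∈ Finset.range (k + 1), c j * (w * Complex.exp s) ^ j
  have hg : AnalyticOnNhd ℂ g Set.univ :=
    (Differentiable.differentiableOn (by fun_prop)).analyticOnNhd isOpen_univ
  rcases (hg 0 trivial).eventually_eq_zero_or_eventually_ne_zero with h | h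
  · exfalso
    have hzero := hg.eqOn_zero_of_preconnected_of_eventuallyEq_zero isPreconnected_univ trivial h
    let p : Polynomial ℂ := ∑ j ∈ Finset.range (k + 1), Polynomial.monomial j (c j)
    have hp : p = 0 := by
      refine Polynomial.eq_zero_of_infinite_isRoot p ?_
      refine (Set.finite_singleton (0 : ℂ)).infinite_compl.mono fun x hx => ?_
      have hx0 : x ≠ 0 := hx
      have h1 := hzero (Set.mem_univ (Complex.log (x / w)))
      simp only [g, Complex.exp_log (div_ne_zero hx0 hw), mul_div_cancel₀ _ hw] at h1
      simpa [p, Polynomial.IsRoot, Polynomial.eval_finsetSum] using h1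
    have : p.coeff k = c k := by
      simp [p, Polynomial.finsetSum_coeff, Polynomial.coeff_monomial]
    rw [hp, Polynomial.coeff_zero] at this
    exact hck this.symm
  · rw [eventually_nhdsWithin_iff, Metric.eventually_nhds_iff] at h
    obtain ⟨ε, hε, h⟩ := h
    refine ⟨ε / 2, by positivity, fun s hs => h ?_ ?_⟩
    · rw [mem_sphere.1 hs]; linarith
    · exact ne_of_mem_sphere hs (by positivity)

/-- The reciprocal of `z / q` at the scale at which the large zeros live. -/
noncomputable def rescaledInv (ζ : ℂ) (q : ℕ) (s : ℂ) : ℂ :=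
  (Real.log q : ℂ) - (Real.log (Real.log q) : ℂ) - ζ - s

section Scaling

variable (ζ : ℂ) (r : ℝ)

theorem tendsto_log_natCast_atTop :
    Tendsto (fun q : ℕ => Real.log q) atTop atTop :=
  Real.tendsto_log_atTop.comp tendsto_natCast_atTop_atTop

theorem tendsto_rescaledInv_div_log :
    Tendsto (fun p : ℕ × ℂ => rescaledInv ζ p.1 p.2 / (Real.log p.1 : ℂ))
      (atTop ×ˢ 𝓟 (closedBall 0 r)) (𝓝 1) := by
  have hL : Tendsto (fun p : ℕ × ℂ => Real.log p.1) (atTop ×ˢ 𝓟 (closedBall 0 r)) atTop :=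
    tendsto_log_natCast_atTop.comp tendsto_fst
  have hloglog : Tendsto (fun p : ℕ × ℂ => ((Real.log (Real.log p.1) / Real.log p.1 : ℝ) : ℂ))
      (atTop ×ˢ 𝓟 (closedBall 0 r)) (𝓝 0) := by
    have := (Real.isLittleO_log_id_atTop.tendsto_div_nhds_zero).comp hL
    exact_mod_cast (Complex.continuous_ofReal.tendsto 0).comp this
  have hrest : Tendsto (fun p : ℕ × ℂ => (ζ + p.2) / (Real.log p.1 : ℂ))
      (atTop ×ˢ 𝓟 (closedBall 0 r)) (𝓝 0) := by
    have hdiv := (tendsto_const_nhds (x := ‖ζ‖ + r)).div_atTop hL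
    refine squeeze_zero_norm' ?_ hdiv
    filter_upwards [hL.eventually_gt_atTop 0,
      tendsto_snd.eventually (mem_principal_self (closedBall (0 : ℂ) r))] with p hp hs
    rw [norm_div, Complex.norm_real, Real.norm_of_nonneg hp.le]
    gcongr
    exact (norm_add_le _ _).trans (by gcongr; simpa using hs)
  have h := ((tendsto_const_nhds (x := (1 : ℂ))).sub hloglog).sub hrest
  rw [sub_zero, sub_zero] at h
  refine h.congr' ?_
  filter_upwards [hL.eventually_gt_atTop 0] with p hp
  have : (Real.log p.1 : ℂ) ≠ 0 := Complex.ofReal_ne_zero.2 hp.ne'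
  rw [rescaledInv, Complex.ofReal_div]
  field_simp
  ring

theorem tendsto_log_pow_div_natCast (m : ℕ) :
    Tendsto (fun q : ℕ => ((Real.log q : ℂ)) ^ m / q) atTop (𝓝 0) := by
  have := (Real.isLittleO_pow_log_id_atTop (n := m)).tendsto_div_nhds_zero.comp
    (tendsto_natCast_atTop_atTop (R := ℝ))
  exact_mod_cast (Complex.continuous_ofReal.tendsto 0).comp this

theorem eventually_rescaledInv_ne_zero :
    ∀ᶠ p : ℕ × ℂ in atTop ×ˢ 𝓟 (closedBall 0 r), p.1 ≠ 0 ∧ Real.log p.1 ≠ 0 ∧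
      rescaledInv ζ p.1 p.2 ≠ 0 := by
  filter_upwards [(tendsto_rescaledInv_div_log ζ r).eventually_ne one_ne_zero] with p hp
  rw [div_ne_zero_iff] at hp
  have hL : Real.log p.1 ≠ 0 := Complex.ofReal_ne_zero.1 hp.2
  refine ⟨?_, hL, hp.1⟩
  rintro h
  simp [h] at hL

theorem tendsto_rescaledInv_pow_div_natCast (m : ℕ) :
    Tendsto (fun p : ℕ × ℂ => rescaledInv ζ p.1 p.2 ^ m / p.1)
      (atTop ×ˢ 𝓟 (closedBall 0 r)) (𝓝 0) := by
  have h := ((tendsto_rescaledInv_div_log ζ r).pow m).mul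
    ((tendsto_log_pow_div_natCast m).comp tendsto_fst)
  rw [mul_zero] at h
  refine h.congr' ?_
  filter_upwards [eventually_rescaledInv_ne_zero ζ r] with p hp
  have : (Real.log p.1 : ℂ) ≠ 0 := Complex.ofReal_ne_zero.2 hp.2.1
  rw [Function.comp_apply, div_pow]
  field_simp

theorem tendsto_re_natCast_div_rescaledInv :
    Tendsto (fun p : ℕ × ℂ => ((p.1 : ℂ) / rescaledInv ζ p.1 p.2).re)
      (atTop ×ˢ 𝓟 (closedBall 0 r)) atTop := by
  have hinv := (tendsto_rescaledInv_div_log ζ r).inv₀ one_ne_zero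
  rw [inv_one] at hinv
  have hre := (Complex.continuous_re.tendsto 1).comp hinv
  rw [Complex.one_re] at hre
  have hq : Tendsto (fun p : ℕ × ℂ => (p.1 : ℝ) / Real.log p.1)
      (atTop ×ˢ 𝓟 (closedBall (0 : ℂ) r)) atTop := by
    refine Tendsto.comp (g := fun q : ℕ => (q : ℝ) / Real.log q) ?_ tendsto_fst
    have h0 : Tendsto (fun q : ℕ => Real.log q / (q : ℝ)) atTop (𝓝[>] 0) := by
      refine tendsto_nhdsWithin_iff.2 ⟨Real.isLittleO_log_id_atTop.tendsto_div_nhds_zero.comp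
        tendsto_natCast_atTop_atTop, ?_⟩
      filter_upwards [tendsto_log_natCast_atTop.eventually_gt_atTop 0, eventually_gt_atTop 0]
        with q h1 h2
      exact div_pos h1 (Nat.cast_pos.2 h2)
    refine h0.inv_tendsto_nhdsGT_zero.congr fun q => ?_
    simp
  refine (hq.atTop_mul_pos one_pos hre).congr' ?_
  filter_upwards [eventually_rescaledInv_ne_zero ζ r] with p hp
  have : (Real.log p.1 : ℂ) ≠ 0 := Complex.ofReal_ne_zero.2 hp.2.1
  rw [Function.comp_apply, ← Complex.re_ofReal_mul]
  rw [Complex.ofReal_div, Complex.ofReal_natCast]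
  congr 1
  field_simp

end Scaling

/-- The factor by which the `j`-th rescaled term differs from its limit. -/
noncomputable def termCorrection (ζ : ℂ) (j q : ℕ) (s : ℂ) : ℂ :=
  (∏ i ∈ Finset.range j, (1 - i * (rescaledInv ζ q s / q))) *
    ((rescaledInv ζ q s / (Real.log q : ℂ))⁻¹) ^ j *
    ((1 - j * (rescaledInv ζ q s / q)) * Complex.exp (j * (rescaledInv ζ q s / q))) ^ q

theorem tendsto_termCorrection (ζ : ℂ) (r : ℝ) (j : ℕ) :
    Tendsto (fun p : ℕ × ℂ => termCorrection ζ j p.1 p.2)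
      (atTop ×ˢ 𝓟 (closedBall 0 r)) (𝓝 1) := by
  have hy : Tendsto (fun p : ℕ × ℂ => rescaledInv ζ p.1 p.2 / p.1)
      (atTop ×ˢ 𝓟 (closedBall 0 r)) (𝓝 0) := by
    simpa using tendsto_rescaledInv_pow_div_natCast ζ r 1
  have hprod : Tendsto (fun p : ℕ × ℂ =>
      ∏ i ∈ Finset.range j, (1 - i * (rescaledInv ζ p.1 p.2 / p.1)))
      (atTop ×ˢ 𝓟 (closedBall 0 r)) (𝓝 1) := by
    have := tendsto_finsetProd (Finset.range j) fun i _ =>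
      (tendsto_const_nhds (x := (1 : ℂ))).sub (hy.const_mul (i : ℂ))
    simpa using this
  have hpow := ((tendsto_rescaledInv_div_log ζ r).inv₀ one_ne_zero).pow j
  have hjy := hy.const_mul (j : ℂ)
  rw [mul_zero] at hjy
  have hjy2 : Tendsto (fun p : ℕ × ℂ => (p.1 : ℂ) * (j * (rescaledInv ζ p.1 p.2 / p.1)) ^ 2)
      (atTop ×ˢ 𝓟 (closedBall 0 r)) (𝓝 0) := by
    have h := (tendsto_rescaledInv_pow_div_natCast ζ r 2).const_mul ((j : ℂ) ^ 2)
    rw [mul_zero] at h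
    refine h.congr' ?_
    filter_upwards [eventually_rescaledInv_ne_zero ζ r] with p hp
    have : (p.1 : ℂ) ≠ 0 := Nat.cast_ne_zero.2 hp.1
    field_simp
  have h := (hprod.mul hpow).mul (tendsto_one_sub_mul_exp_pow hjy hjy2)
  simpa only [termCorrection, one_mul, inv_one, one_pow] using h

theorem rescaled_term_eq {ζ : ℂ} {q : ℕ} {s : ℂ} (hq : q ≠ 0) (hL : Real.log q ≠ 0)
    (hu : rescaledInv ζ q s ≠ 0) (j : ℕ) :
    (∏ i ∈ Finset.range j, ((q : ℂ) / rescaledInv ζ q s - i)) *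
        ((q : ℂ) / rescaledInv ζ q s - j) ^ q * (rescaledInv ζ q s / q) ^ q =
      (Complex.exp ζ * Complex.exp s) ^ j * termCorrection ζ j q s := by
  have hqc : (q : ℂ) ≠ 0 := Nat.cast_ne_zero.2 hq
  have hLc : (Real.log q : ℂ) ≠ 0 := Complex.ofReal_ne_zero.2 hL
  have hexp : Complex.exp (rescaledInv ζ q s) * (Complex.exp ζ * Complex.exp s) *
      (Real.log q : ℂ) = q := by
    have hq' : Complex.exp (Real.log q : ℂ) = q := by
      rw [← Complex.ofReal_exp, Real.exp_log (by positivity), Complex.ofReal_natCast]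
    have hlog : 0 < Real.log q := lt_of_le_of_ne (Real.log_natCast_nonneg q) hL.symm
    have hL' : Complex.exp (Real.log (Real.log q) : ℂ) = (Real.log q : ℂ) := by
      rw [← Complex.ofReal_exp, Real.exp_log hlog]
    rw [← hL', ← Complex.exp_add, ← Complex.exp_add, ← Complex.exp_add, ← hq', rescaledInv]
    congr 1
    ring
  have hprod : ∏ i ∈ Finset.range j, ((q : ℂ) / rescaledInv ζ q s - i) =
      (∏ i ∈ Finset.range j, (1 - i * (rescaledInv ζ q s / q))) *
        ((q : ℂ) / rescaledInv ζ q s) ^ j := by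
    rw [← Finset.card_range j, ← Finset.prod_const, Finset.card_range, ← Finset.prod_mul_distrib]
    refine Finset.prod_congr rfl fun i _ => ?_
    field_simp
  have hpowexp : Complex.exp (j * (rescaledInv ζ q s / q)) ^ q =
      Complex.exp (rescaledInv ζ q s) ^ j := by
    rw [← Complex.exp_nat_mul, ← Complex.exp_nat_mul]
    congr 1
    field_simp
  have hbase : (q : ℂ) / rescaledInv ζ q s = Complex.exp ζ * Complex.exp s *
      (rescaledInv ζ q s / (Real.log q : ℂ))⁻¹ * Complex.exp (rescaledInv ζ q s) := by
    nth_rewrite 1 [← hexp]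
    field_simp
  have hlast : ((q : ℂ) / rescaledInv ζ q s - j) ^ q * (rescaledInv ζ q s / q) ^ q =
      (1 - j * (rescaledInv ζ q s / q)) ^ q := by
    rw [← mul_pow]
    congr 1
    field_simp
  rw [mul_assoc, hlast, hprod, termCorrection, mul_pow (1 - _), hpowexp, hbase]
  ring

/-- For large `q`, the polynomial `∑ⱼ cⱼ z(z-1)⋯(z-j+1) (z-j)^q` has roots of large real part. -/
theorem eventually_exists_root_re_gt {k : ℕ} (hk : 2 ≤ k) {c : ℕ → ℂ} (h0 : c 0 = 0)
    (h1 : c 1 ≠ 0) (hck : c k ≠ 0) (R : ℝ) :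
    ∀ᶠ q : ℕ in atTop, ∃ z : ℂ, ∑ j ∈ Finset.range (k + 1),
      c j * ((∏ i ∈ Finset.range j, (z - i)) * (z - j) ^ q) = 0 ∧ R < z.re := by
  obtain ⟨w, hw, hroot⟩ := exists_ne_zero_sum_pow_eq_zero hk h0 h1 hck
  obtain ⟨r, hr, hsphere⟩ := exists_sphere_sum_exp_pow_ne_zero hck hw
  obtain ⟨ζ, rfl⟩ : ∃ ζ, Complex.exp ζ = w := ⟨_, Complex.exp_log hw⟩
  let Q : ℕ → ℂ → ℂ := fun q z => ∑ j ∈ Finset.range (k + 1),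
    c j * ((∏ i ∈ Finset.range j, (z - i)) * (z - j) ^ q)
  let F : ℕ → ℂ → ℂ := fun q s => Q q (q / rescaledInv ζ q s) * (rescaledInv ζ q s / q) ^ q
  let g : ℂ → ℂ := fun s =>
    ∑ j ∈ Finset.range (k + 1), c j * (Complex.exp ζ * Complex.exp s) ^ j
  have hnz := eventually_prod_principal_iff.1 (eventually_rescaledInv_ne_zero ζ r)
  have hdiff : ∀ᶠ q in atTop, DifferentiableOn ℂ (F q) (closedBall 0 r) := by
    filter_upwards [hnz] with q hq
    have hu : DifferentiableOn ℂ (fun s => rescaledInv ζ q s) (closedBall 0 r) := by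
      unfold rescaledInv
      fun_prop
    have hQ : Differentiable ℂ (Q q) := by fun_prop
    refine (hQ.comp_differentiableOn
      ((differentiableOn_const _).div hu fun s hs => (hq s hs).2.2)).mul ?_
    exact (hu.div_const _).pow q
  have hlim : TendstoUniformlyOn F g atTop (closedBall 0 r) := by
    have hsum : Tendsto (fun p : ℕ × ℂ => ∑ j ∈ Finset.range (k + 1),
        c j * (Complex.exp ζ * Complex.exp p.2) ^ j * (termCorrection ζ j p.1 p.2 - 1))
        (atTop ×ˢ 𝓟 (closedBall 0 r)) (𝓝 0) := by
      suffices h : ∀ j ∈ Finset.range (k + 1), Tendsto (fun p : ℕ × ℂ =>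
          c j * (Complex.exp ζ * Complex.exp p.2) ^ j * (termCorrection ζ j p.1 p.2 - 1))
          (atTop ×ˢ 𝓟 (closedBall 0 r)) (𝓝 0) by
        simpa using tendsto_finsetSum _ h
      intro j _
      obtain ⟨C, hC⟩ := (isCompact_closedBall (0 : ℂ) r).exists_bound_of_continuousOn
        (f := fun s => c j * (Complex.exp ζ * Complex.exp s) ^ j) (by fun_prop)
      have hcorr := ((tendsto_termCorrection ζ r j).sub_const 1).norm.const_mul C
      rw [sub_self, norm_zero, mul_zero] at hcorr
      refine squeeze_zero_norm' ?_ hcorr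
      filter_upwards [tendsto_snd.eventually (mem_principal_self (closedBall (0 : ℂ) r))]
        with p hp
      rw [norm_mul]
      gcongr
      exact hC p.2 hp
    rw [Metric.tendstoUniformlyOn_iff]
    intro ε hε
    rw [← eventually_prod_principal_iff (p := fun x : ℕ × ℂ => dist (g x.2) (F x.1 x.2) < ε)]
    filter_upwards [(Metric.tendsto_nhds.1 hsum) ε hε, eventually_rescaledInv_ne_zero ζ r]
      with p hp hne
    convert hp using 1
    rw [dist_comm, dist_eq_norm, dist_zero_right]
    congr 1
    simp only [F, Q, g, Finset.sum_mul, ← Finset.sum_sub_distrib]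
    refine Finset.sum_congr rfl fun j _ => ?_
    rw [mul_assoc, rescaled_term_eq hne.1 hne.2.1 hne.2.2]
    ring
  have hzero := eventually_exists_zero_of_tendstoUniformlyOn hr hdiff hlim
    (by fun_prop) (by simpa [g] using hroot) hsphere
  have hre := eventually_prod_principal_iff.1
    ((tendsto_re_natCast_div_rescaledInv ζ r).eventually_gt_atTop R)
  filter_upwards [hzero, hre, hnz] with q ⟨s, hs, hFs⟩ hq hn
  obtain ⟨hq0, -, hu⟩ := hn s hs
  exact ⟨q / rescaledInv ζ q s, (mul_eq_zero.1 hFs).resolve_right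
    (pow_ne_zero _ (div_ne_zero hu (Nat.cast_ne_zero.2 hq0))), hq s hs⟩

/-- A proper coloring of `K_{V,W}` is a map on `V` together with a map on `W` avoiding its range. -/
def completeBipartiteColoringEquiv (V W α : Type*) :
    (completeBipartiteGraph V W).Coloring α ≃
      Σ f : V → α, (W → {x // x ∉ Set.range f}) where
  toFun C := ⟨fun v => C (Sum.inl v), fun w => ⟨C (Sum.inr w), by
    rintro ⟨v, hv⟩
    exact C.valid (v := Sum.inl v) (w := Sum.inr w) (by simp) hv⟩⟩
  invFun p := SimpleGraph.Coloring.mk (Sum.elim p.1 fun w => (p.2 w : α)) (by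
    rintro (v | v) (w | w) h
    · simp at h
    · exact fun heq => (p.2 w).2 ⟨v, heq⟩
    · exact fun heq => (p.2 v).2 ⟨w, heq.symm⟩
    · simp at h)
  left_inv C := by
    ext (v | v) <;> rfl
  right_inv p := rfl

/-- The number of surjections from a set of size `k` onto a set of size `j`. -/
noncomputable def surjectionCount (k j : ℕ) : ℕ :=
  Nat.card {f : Fin k → Fin j // Function.Surjective f}

theorem surjectionCount_eq_zero_of_lt {k j : ℕ} (h : k < j) : surjectionCount k j = 0 := by
  rw [surjectionCount, Nat.card_eq_zero]
  refine Or.inl ⟨fun f => ?_⟩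
  have := Fintype.card_le_of_surjective _ f.2
  simp only [Fintype.card_fin] at this
  omega

theorem surjectionCount_ne_zero {k j : ℕ} (hj : j ≠ 0) (h : j ≤ k) : surjectionCount k j ≠ 0 := by
  have : NeZero j := ⟨hj⟩
  have : Nonempty {f : Fin k → Fin j // Function.Surjective f} :=
    ⟨⟨_, Function.invFun_surjective (Fin.castLE_injective h)⟩⟩
  exact Nat.card_ne_zero.2 ⟨this, inferInstance⟩

theorem surjectionCount_zero_right {k : ℕ} (hk : k ≠ 0) : surjectionCount k 0 = 0 := by
  have : NeZero k := ⟨hk⟩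
  rw [surjectionCount, Nat.card_eq_zero]
  exact Or.inl ⟨fun f => (f.1 0).elim0⟩

theorem card_filter_image_eq {n : ℕ} (k : ℕ) (S : Finset (Fin n)) :
    (Finset.univ.filter fun f : Fin k → Fin n => Finset.univ.image f = S).card =
      surjectionCount k S.card := by
  rw [surjectionCount, ← Fintype.card_subtype, ← Nat.card_eq_fintype_card]
  refine Nat.card_congr ?_
  refine Equiv.trans (β := {f : Fin k → S // Function.Surjective f}) ?_
    ((Equiv.arrowCongr (Equiv.refl _) S.equivFin).subtypeEquiv fun f => ?_)
  · exact
      { toFun := fun f => ⟨fun i => ⟨f.1 i, 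
            f.2.subset (Finset.mem_image_of_mem _ (Finset.mem_univ i))⟩, by
          rintro ⟨x, hx⟩
          rw [← f.2] at hx
          obtain ⟨i, -, hi⟩ := Finset.mem_image.1 hx
          exact ⟨i, Subtype.ext hi⟩⟩
        invFun := fun f => ⟨fun i => f.1 i, by
          ext x
          simp only [Finset.mem_image, Finset.mem_univ, true_and]
          refine ⟨?_, fun hx => ?_⟩
          · rintro ⟨i, rfl⟩
            exact (f.1 i).2
          · obtain ⟨i, hi⟩ := f.2 ⟨x, hx⟩
            exact ⟨i, congrArg Subtype.val hi⟩⟩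
        left_inv := fun f => rfl
        right_inv := fun f => rfl }
  · simp [Equiv.arrowCongr]

theorem card_coloring_completeBipartiteGraph (k q n : ℕ) :
    Nat.card ((completeBipartiteGraph (Fin k) (Fin q)).Coloring (Fin n)) =
      ∑ j ∈ Finset.range (k + 1), n.choose j * (surjectionCount k j * (n - j) ^ q) := by
  classical
  calc _ = ∑ f : Fin k → Fin n, (n - (Finset.univ.image f).card) ^ q := by
        rw [Nat.card_congr (completeBipartiteColoringEquiv _ _ _), Nat.card_sigma]
        refine Finset.sum_congr rfl fun f _ => ?_
        rw [Nat.card_fun, Nat.card_eq_fintype_card, Nat.card_eq_fintype_card, Fintype.card_fin,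
          Fintype.card_subtype_compl, Fintype.card_fin, Fintype.card_subtype]
        congr 3
        ext x
        simp
    _ = ∑ S : Finset (Fin n), surjectionCount k S.card * (n - S.card) ^ q := by
        rw [← Finset.sum_fiberwise (s := Finset.univ)
          (g := fun f : Fin k → Fin n => Finset.univ.image f)]
        refine Finset.sum_congr rfl fun S _ => ?_
        rw [← card_filter_image_eq, ← smul_eq_mul, ← Finset.sum_const]
        refine Finset.sum_congr rfl fun f hf => ?_
        rw [(Finset.mem_filter.1 hf).2]
    _ = ∑ j ∈ Finset.range (n + 1), n.choose j * (surjectionCount k j * (n - j) ^ q) := by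
        have := Finset.sum_powerset_apply_card
          (fun j => surjectionCount k j * (n - j) ^ q) (x := (Finset.univ : Finset (Fin n)))
        simpa using this
    _ = ∑ j ∈ Finset.range (n + k + 1), n.choose j * (surjectionCount k j * (n - j) ^ q) := by
        refine Finset.sum_subset (Finset.range_mono (by omega)) fun j _ hj => ?_
        rw [Nat.choose_eq_zero_of_lt (by simpa using hj), zero_mul]
    _ = _ := by
        refine (Finset.sum_subset (Finset.range_mono (by omega)) fun j _ hj => ?_).symm
        rw [surjectionCount_eq_zero_of_lt (by simpa using hj), zero_mul, mul_zero]

/-- The chromatic polynomial of `K_{k,q}` in terms of falling factorials. -/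
theorem IsChromaticPoly.eval_eq {k q : ℕ} {P : Polynomial ℂ}
    (hP : IsChromaticPoly (completeBipartiteGraph (Fin k) (Fin q)) P) (z : ℂ) :
    P.eval z = ∑ j ∈ Finset.range (k + 1), ((surjectionCount k j : ℂ) / (j.factorial : ℂ)) *
      ((∏ i ∈ Finset.range j, (z - i)) * (z - j) ^ q) := by
  let Q : Polynomial ℂ := ∑ j ∈ Finset.range (k + 1),
    Polynomial.C ((surjectionCount k j : ℂ) / (j.factorial : ℂ)) *
      (descPochhammer ℂ j * (Polynomial.X - Polynomial.C (j : ℂ)) ^ q)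
  have hQ (x : ℂ) : Q.eval x = ∑ j ∈ Finset.range (k + 1),
      ((surjectionCount k j : ℂ) / (j.factorial : ℂ)) *
        ((∏ i ∈ Finset.range j, (x - i)) * (x - j) ^ q) := by
    simp [Q, Polynomial.eval_finsetSum, descPochhammer_eval_eq_prod_range]
  rw [← hQ]
  congr 1
  refine Polynomial.eq_of_infinite_eval_eq P Q
    ((Set.infinite_range_of_injective (Nat.cast_injective (R := ℂ))).mono ?_)
  rintro _ ⟨n, rfl⟩
  rw [Set.mem_ofPred_eq, hP n, card_coloring_completeBipartiteGraph, hQ, Nat.cast_sum]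
  refine Finset.sum_congr rfl fun j _ => ?_
  rw [← descPochhammer_eval_eq_prod_range, Nat.cast_mul, Nat.cast_choose_eq_descPochhammer_div]
  rcases le_or_gt j n with h | h
  · push_cast [Nat.cast_sub h]
    ring
  · rw [descPochhammer_eval_coe_nat_of_lt h]
    simp

/-- For every integer `k ≥ 2`, the set of integers `q` such that the complete bipartite graph
`K_{k,q}` has a chromatic root `z` with `Re z > k` is infinite. -/
theorem infinite_q_with_chromatic_root_re_gt (k : ℕ) (hk : 2 ≤ k) :
    {q : ℕ | ∀ P : Polynomial ℂ,
      IsChromaticPoly (completeBipartiteGraph (Fin k) (Fin q)) P →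
        ∃ z : ℂ, P.eval z = 0 ∧ (k : ℝ) < z.re}.Infinite := by
  have hroots := eventually_exists_root_re_gt hk
    (c := fun j => (surjectionCount k j : ℂ) / (j.factorial : ℂ))
    (by simp [surjectionCount_zero_right (by omega : k ≠ 0)])
    (div_ne_zero (Nat.cast_ne_zero.2 (surjectionCount_ne_zero one_ne_zero (by omega)))
      (Nat.cast_ne_zero.2 (Nat.factorial_ne_zero _)))
    (div_ne_zero (Nat.cast_ne_zero.2 (surjectionCount_ne_zero (by omega) le_rfl))
      (Nat.cast_ne_zero.2 (Nat.factorial_ne_zero _))) k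
  refine Nat.frequently_atTop_iff_infinite.1 (Eventually.frequently ?_)
  filter_upwards [hroots] with q ⟨z, hz, hre⟩ P hP
  exact ⟨z, by rw [hP.eval_eq, hz], hre⟩
end

section
/- Let G be a finite simple graph of order n and size m with girth g (G contains a cycle), and write π(G,x) = Σ_{i=1}^{n} (−1)^{n−i} h_i x^i. Then h_{n−g+1} = C(m, g−1) − η_G(C_g), where η_G(C_g) is the number of subgraphs of G isomorphic to the cycle C_g of length g. -/
open Polynomial

/-- `eta G H` is the number of subgraphs of `G` isomorphic to `H`. -/
noncomputable def eta {V W : Type*} (G : SimpleGraph V) (H : SimpleGraph W) : ℕ :=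
  Nat.card {G' : G.Subgraph // Nonempty (G'.coe ≃g H)}

namespace SimpleGraph

variable {V : Type*} {G H : SimpleGraph V} {u v x y : V} {e : Sym2 V}

theorem edgeSet_fromEdgeSet_of_subset {S : Set (Sym2 V)} (hS : S ⊆ G.edgeSet) :
    (fromEdgeSet S).edgeSet = S := by
  rw [edgeSet_fromEdgeSet]
  exact sdiff_eq_left.mpr (Set.disjoint_left.mpr fun e he hd ↦
    G.not_isDiag_of_mem_edgeSet (hS he) hd)

/-- Restoring a deleted edge `uv` only creates connections through `u` and `v`. -/
theorem Reachable.deleteEdges_singleton_cases (h : H.Reachable x y) (u v : V) :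
    (H.deleteEdges {s(u, v)}).Reachable x y ∨
      ((H.deleteEdges {s(u, v)}).Reachable x u ∧ (H.deleteEdges {s(u, v)}).Reachable v y) ∨
      ((H.deleteEdges {s(u, v)}).Reachable x v ∧ (H.deleteEdges {s(u, v)}).Reachable u y) := by
  obtain ⟨w⟩ := h
  induction w with
  | nil => exact .inl .rfl
  | @cons a b c hab p ih =>
    by_cases he : s(a, b) = s(u, v)
    · rcases Sym2.eq_iff.mp he with ⟨rfl, rfl⟩ | ⟨rfl, rfl⟩
      · rcases ih with h | ⟨-, h⟩ | ⟨-, h⟩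
        · exact .inr (.inl ⟨.rfl, h⟩)
        · exact .inr (.inl ⟨.rfl, h⟩)
        · exact .inl h
      · rcases ih with h | ⟨-, h⟩ | ⟨-, h⟩
        · exact .inr (.inr ⟨.rfl, h⟩)
        · exact .inl h
        · exact .inr (.inr ⟨.rfl, h⟩)
    · have hab' : (H.deleteEdges {s(u, v)}).Reachable a b :=
        Adj.reachable (by simpa [deleteEdges_adj, hab] using he)
      exact ih.imp hab'.trans (.imp (.imp_left hab'.trans) (.imp_left hab'.trans))

theorem card_connectedComponent_deleteEdges_of_not_isBridge (he : ¬ H.IsBridge e) :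
    Nat.card (H.deleteEdges {e}).ConnectedComponent = Nat.card H.ConnectedComponent := by
  induction e with | h u v
  rw [isBridge_iff, not_not] at he
  refine Nat.card_eq_of_bijective (ConnectedComponent.map (.ofLE (deleteEdges_le {s(u, v)})))
    ⟨?_, ConnectedComponent.surjective_map_ofLE _⟩
  refine ConnectedComponent.ind₂ fun x y hxy ↦ ConnectedComponent.sound ?_
  rcases (ConnectedComponent.exact hxy : H.Reachable x y).deleteEdges_singleton_cases u v with
    h | ⟨h, h'⟩ | ⟨h, h'⟩
  · exact h
  · exact h.trans (he.trans h')
  · exact h.trans (he.symm.trans h')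

theorem card_connectedComponent_deleteEdges_of_isBridge [Finite V] (he : e ∈ H.edgeSet)
    (hb : H.IsBridge e) :
    Nat.card (H.deleteEdges {e}).ConnectedComponent = Nat.card H.ConnectedComponent + 1 := by
  induction e with | h u v
  rw [isBridge_iff] at hb
  set K := H.deleteEdges {s(u, v)} with hK
  have hle : K ≤ H := deleteEdges_le _
  have key : Nat.card {c : K.ConnectedComponent // c ≠ K.connectedComponentMk v} =
      Nat.card H.ConnectedComponent := by
    refine Nat.card_eq_of_bijective (fun c ↦ c.1.map (.ofLE hle)) ⟨?_, ?_⟩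
    · rintro ⟨c, hc⟩ ⟨d, hd⟩ hcd
      induction c, d using ConnectedComponent.ind₂ with | h x y
      refine Subtype.ext (ConnectedComponent.sound ?_)
      rcases (ConnectedComponent.exact hcd : H.Reachable x y).deleteEdges_singleton_cases u v with
        h | ⟨-, h⟩ | ⟨h, -⟩
      · exact h
      · exact absurd (ConnectedComponent.sound h.symm) hd
      · exact absurd (ConnectedComponent.sound h) hc
    · refine ConnectedComponent.ind fun x ↦ ?_
      by_cases hx : K.Reachable x v
      · exact ⟨⟨K.connectedComponentMk u, fun h ↦ hb (ConnectedComponent.exact h)⟩,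
          ConnectedComponent.sound ((Adj.reachable he).trans (hx.mono hle).symm)⟩
      · exact ⟨⟨K.connectedComponentMk x, fun h ↦ hx (ConnectedComponent.exact h)⟩, rfl⟩
  have := Set.ncard_add_ncard_compl {K.connectedComponentMk v}
  rw [Set.ncard_singleton, ← Nat.card_coe_set_eq] at this
  rw [← key, ← this, add_comm]
  rfl

theorem ncard_edgeSet_deleteEdges_singleton [Finite V] (he : e ∈ H.edgeSet) :
    (H.deleteEdges {e}).edgeSet.ncard + 1 = H.edgeSet.ncard := by
  rw [edgeSet_deleteEdges, Set.ncard_sdiff_singleton_add_one he]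

/-- A forest on `n` vertices with `c` components has `n - c` edges. -/
theorem IsAcyclic.card_connectedComponent_add_ncard_edgeSet [Finite V] (hH : H.IsAcyclic) :
    Nat.card H.ConnectedComponent + H.edgeSet.ncard = Nat.card V := by
  induction hk : H.edgeSet.ncard generalizing H with
  | zero =>
    rw [Set.ncard_eq_zero, edgeSet_eq_empty] at hk
    subst hk
    refine (Nat.card_eq_of_bijective (connectedComponentMk ⊥) ⟨fun x y hxy ↦ ?_, ?_⟩).symm
    · simpa using ConnectedComponent.exact hxy
    · exact ConnectedComponent.ind fun x ↦ ⟨x, rfl⟩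
  | succ k ih =>
    obtain ⟨e, he⟩ : H.edgeSet.Nonempty := Set.nonempty_of_ncard_ne_zero (by omega)
    have h₁ := ncard_edgeSet_deleteEdges_singleton he
    have h₂ := card_connectedComponent_deleteEdges_of_isBridge he
      (isAcyclic_iff_forall_isBridge.mp hH he)
    have h₃ := ih (hH.anti (deleteEdges_le {e})) (by omega)
    omega

theorem Walk.ncard_setOf_mem_edges {p : H.Walk x y} (hp : p.IsTrail) :
    {e | e ∈ p.edges}.ncard = p.length := by
  classical
  rw [← p.length_edges, ← List.toFinset_card_of_nodup hp.edges_nodup, ← Set.ncard_coe_finset,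
    List.coe_toFinset]

theorem Walk.IsTrail.length_le_ncard_edgeSet [Finite V] {p : H.Walk x y} (hp : p.IsTrail) :
    p.length ≤ H.edgeSet.ncard := by
  rw [← ncard_setOf_mem_edges hp]
  exact Set.ncard_le_ncard fun _ he ↦ p.edges_subset_edgeSet he

theorem isAcyclic_of_ncard_edgeSet_lt_egirth [Finite V] (hHG : H ≤ G)
    (hlt : (H.edgeSet.ncard : ℕ∞) < G.egirth) : H.IsAcyclic := by
  intro a w hw
  have h₁ := (egirth_anti hHG).trans (egirth_le_length hw)
  have h₂ : (w.length : ℕ∞) ≤ H.edgeSet.ncard := mod_cast hw.isTrail.length_le_ncard_edgeSet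
  exact (hlt.trans_le h₁).not_ge h₂

/-- A shortest cycle has no chords. -/
theorem Walk.IsCycle.mem_edges_of_length_le_egirth {a : V} {w : G.Walk a a} (hw : w.IsCycle)
    (hlen : (w.length : ℕ∞) ≤ G.egirth) (hu : u ∈ w.support) (hv : v ∈ w.support)
    (huv : G.Adj u v) : s(u, v) ∈ w.edges := by
  classical
  by_contra hmem
  set c := w.rotate u hu with hc
  have hcyc : c.IsCycle := hw.rotate hu
  have hclen : c.length = w.length := by simp [hc]
  have hvc : v ∈ c.support := by simpa [hc] using hv
  have hce : s(u, v) ∉ c.edges := fun h ↦ hmem ((w.rotate_edges u hu).mem_iff.mp h)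
  have hspec := c.take_spec hvc
  have hp : (c.takeUntil v hvc).IsPath := hcyc.isPath_takeUntil hvc
  have hq : (c.dropUntil v hvc).IsPath := by
    refine IsCycle.isPath_of_append_right (p := c.takeUntil v hvc) ?_ (hspec.symm ▸ hcyc)
    exact fun h ↦ huv.ne h.eq
  have h₁ := hlen.trans (egirth_le_length ((cons_isCycle_iff _ huv.symm).mpr
    ⟨hp, fun h ↦ hce (Sym2.eq_swap ▸ c.edges_takeUntil_subset_edges hvc h)⟩))
  have h₂ := hlen.trans (egirth_le_length ((cons_isCycle_iff _ huv).mpr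
    ⟨hq, fun h ↦ hce (c.edges_dropUntil_subset_edges hvc h)⟩))
  have h₃ := congrArg length hspec
  have h₄ := hw.three_le_length
  simp only [length_cons, Nat.cast_le, length_append] at h₁ h₂ h₃
  omega

theorem Reachable.exists_adj (h : H.Reachable x y) (hne : x ≠ y) : ∃ z, H.Adj x z := by
  obtain ⟨w⟩ := h
  cases w with
  | nil => exact absurd rfl hne
  | cons h _ => exact ⟨_, h⟩

theorem card_connectedComponent_of_not_isAcyclic [Finite V] (hH : ¬ H.IsAcyclic)
    (hlt : ∀ e ∈ H.edgeSet, (H.deleteEdges {e}).IsAcyclic) :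
    Nat.card H.ConnectedComponent + H.edgeSet.ncard = Nat.card V + 1 := by
  obtain ⟨e, he, hb⟩ : ∃ e ∈ H.edgeSet, ¬ H.IsBridge e := by
    simpa [isAcyclic_iff_forall_isBridge] using hH
  have h₁ := ncard_edgeSet_deleteEdges_singleton he
  have h₂ := card_connectedComponent_deleteEdges_of_not_isBridge hb
  have h₃ := (hlt e he).card_connectedComponent_add_ncard_edgeSet
  omega

theorem card_connectedComponent_of_ncard_edgeSet_le_egirth [Finite V] (hHG : H ≤ G)
    (hH : ¬ H.IsAcyclic) (hcard : (H.edgeSet.ncard : ℕ∞) ≤ G.egirth) :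
    Nat.card H.ConnectedComponent + H.edgeSet.ncard = Nat.card V + 1 := by
  refine card_connectedComponent_of_not_isAcyclic hH fun e he ↦
    isAcyclic_of_ncard_edgeSet_lt_egirth ((deleteEdges_le _).trans hHG) (hcard.trans_lt' ?_)
  have := ncard_edgeSet_deleteEdges_singleton he
  exact_mod_cast (by omega)

/-- A non-acyclic subgraph with `n - g + 1` components, `g` being the girth, is a `g`-cycle. -/
theorem ncard_edgeSet_eq_of_card_connectedComponent [Finite V] {g : ℕ} (hg : G.egirth = g)
    (hHG : H ≤ G) (hH : ¬ H.IsAcyclic)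
    (hc : Nat.card H.ConnectedComponent + g = Nat.card V + 1) : H.edgeSet.ncard = g := by
  obtain ⟨a, w, hw, hlen⟩ := exists_egirth_eq_length.mpr hH
  set K := fromEdgeSet {e | e ∈ w.edges} with hK
  have hKedge : K.edgeSet = {e | e ∈ w.edges} := by
    exact edgeSet_fromEdgeSet_of_subset fun _ he ↦ w.edges_subset_edgeSet he
  have hKH : K ≤ H := edgeSet_subset_edgeSet.mp
    (hKedge.trans_subset fun _ he ↦ w.edges_subset_edgeSet he)
  have hKcard : K.edgeSet.ncard = w.length := hKedge ▸ Walk.ncard_setOf_mem_edges hw.isTrail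
  have hKcyc : ¬ K.IsAcyclic := fun h ↦
    h _ (hw.transfer (H := K) fun e he ↦ hKedge.symm ▸ he)
  have hKc := card_connectedComponent_of_ncard_edgeSet_le_egirth hKH hKcyc (by rw [hKcard, hlen])
  have hle := ConnectedComponent.card_le_card_of_le hKH
  have hgw : g ≤ w.length := by
    have := egirth_anti hHG
    rw [hg, hlen] at this
    exact_mod_cast this
  have hwg : w.length = g := by omega
  have hinj : Function.Injective (ConnectedComponent.map (Hom.ofLE hKH)) :=
    ((Nat.bijective_iff_surjective_and_card _).mpr
      ⟨ConnectedComponent.surjective_map_ofLE hKH, by omega⟩).1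
  have hsupp {x y : V} (hxy : H.Adj x y) : x ∈ w.support := by
    have hr : K.Reachable x y := ConnectedComponent.exact
      (hinj (ConnectedComponent.sound hxy.reachable))
    obtain ⟨z, hz⟩ := hr.exists_adj hxy.ne
    exact w.fst_mem_support_of_mem_edges (hKedge.subset hz)
  have hHK : H ≤ K := by
    intro x y hxy
    rw [← mem_edgeSet, hKedge]
    exact hw.mem_edges_of_length_le_egirth hlen.ge (hsupp hxy) (hsupp hxy.symm) hxy
  rw [hHK.antisymm hKH, hKcard, hwg]

theorem card_connectedComponent_add_girth_iff [Finite V] {g : ℕ} (hg : G.egirth = g)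
    (hHG : H ≤ G) :
    Nat.card H.ConnectedComponent + g = Nat.card V + 1 ↔
      H.edgeSet.ncard + 1 = g ∨ H.edgeSet.ncard = g ∧ ¬ H.IsAcyclic := by
  constructor
  · intro h
    by_cases hH : H.IsAcyclic
    · have := hH.card_connectedComponent_add_ncard_edgeSet
      exact .inl (by omega)
    · exact .inr ⟨ncard_edgeSet_eq_of_card_connectedComponent hg hHG hH h, hH⟩
  · rintro (h | ⟨h, hH⟩)
    · have := (isAcyclic_of_ncard_edgeSet_lt_egirth hHG
        (by rw [hg]; exact_mod_cast (by omega))).card_connectedComponent_add_ncard_edgeSet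
      omega
    · rw [← h]
      exact card_connectedComponent_of_ncard_edgeSet_le_egirth hHG hH (by rw [hg, h])

theorem ncard_edgeSet_cycleGraph {g : ℕ} (hg : 3 ≤ g) : (cycleGraph g).edgeSet.ncard = g := by
  obtain ⟨k, rfl⟩ := Nat.exists_eq_add_of_le' hg
  have h := (cycleGraph (k + 3)).sum_degrees_eq_twice_card_edges
  simp only [cycleGraph_degree_three_le, Finset.sum_const, Finset.card_univ, Fintype.card_fin,
    smul_eq_mul] at h
  rw [← coe_edgeFinset, Set.ncard_coe_finset]
  omega

theorem not_isAcyclic_cycleGraph {g : ℕ} (hg : 3 ≤ g) : ¬ (cycleGraph g).IsAcyclic := by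
  obtain ⟨k, rfl⟩ := Nat.exists_eq_add_of_le' hg
  exact fun h ↦ h _ cycleGraph.isCycle_cycle

theorem exists_cycleGraph_adj {g : ℕ} (hg : 3 ≤ g) (x : Fin g) : ∃ y, (cycleGraph g).Adj x y := by
  obtain ⟨k, rfl⟩ := Nat.exists_eq_add_of_le' hg
  exact ⟨x + 1, by simp [cycleGraph_adj]⟩

theorem Subgraph.ncard_edgeSet_of_iso {W : Type*} {K : SimpleGraph W} {G' : G.Subgraph}
    (f : G'.coe ≃g K) : G'.edgeSet.ncard = K.edgeSet.ncard := by
  rw [← Subgraph.image_coe_edgeSet_coe, Set.ncard_image_of_injective _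
    (Sym2.map.injective Subtype.val_injective), ← Nat.card_coe_set_eq, ← Nat.card_coe_set_eq]
  exact Nat.card_congr f.mapEdgeSet

theorem Subgraph.support_eq_verts_of_iso_cycleGraph {g : ℕ} (hg : 3 ≤ g) {G' : G.Subgraph}
    (f : G'.coe ≃g cycleGraph g) : G'.support = G'.verts := by
  refine G'.support_subset_verts.antisymm fun x hx ↦ ?_
  obtain ⟨y, hy⟩ := exists_cycleGraph_adj hg (f ⟨x, hx⟩)
  refine ⟨f.symm y, ?_⟩
  rw [← f.symm.map_adj_iff, f.symm_apply_apply] at hy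
  exact hy

/-- If `g` is the girth of `G`, the `g`-cycles in `G` correspond to the sets of `g` edges which
span a graph that is not acyclic. -/
theorem eta_cycleGraph_eq_ncard [Finite V] {g : ℕ} (hg : G.egirth = g) :
    eta G (cycleGraph g) =
      {S : Set (Sym2 V) | S ⊆ G.edgeSet ∧ S.ncard = g ∧ ¬ (fromEdgeSet S).IsAcyclic}.ncard := by
  have hg3 : 3 ≤ g := by exact_mod_cast hg ▸ G.three_le_egirth
  rw [_root_.eta, ← Nat.card_coe_set_eq]
  refine Nat.card_eq_of_bijective (fun G' ↦ ⟨G'.1.edgeSet, G'.1.edgeSet_subset, ?_, ?_⟩) ⟨?_, ?_⟩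
  · obtain ⟨G', ⟨f⟩⟩ := G'
    exact (Subgraph.ncard_edgeSet_of_iso f).trans (ncard_edgeSet_cycleGraph hg3)
  · obtain ⟨G', ⟨f⟩⟩ := G'
    intro h
    refine not_isAcyclic_cycleGraph hg3 (f.isAcyclic_iff.mp (h.comap
      (⟨Subtype.val, fun {a b} hab ↦ ?_⟩ : G'.coe →g fromEdgeSet G'.edgeSet)
      Subtype.val_injective))
    exact (fromEdgeSet_adj _).mpr ⟨hab, Subtype.coe_ne_coe.mpr hab.ne⟩
  · rintro ⟨G₁, ⟨f₁⟩⟩ ⟨G₂, ⟨f₂⟩⟩ h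
    have hE : G₁.edgeSet = G₂.edgeSet := congrArg Subtype.val h
    have hAdj : G₁.Adj = G₂.Adj := by
      ext x y
      rw [← Subgraph.mem_edgeSet, hE, Subgraph.mem_edgeSet]
    refine Subtype.ext (Subgraph.ext ?_ hAdj)
    rw [← Subgraph.support_eq_verts_of_iso_cycleGraph hg3 f₁,
      ← Subgraph.support_eq_verts_of_iso_cycleGraph hg3 f₂]
    ext x
    simp only [Subgraph.mem_support, hAdj]
  · rintro ⟨S, hSG, hSg, hS⟩
    have hle : fromEdgeSet S ≤ G := by
      simpa using fromEdgeSet_mono hSG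
    have hdiag : (fromEdgeSet S).edgeSet = S := edgeSet_fromEdgeSet_of_subset hSG
    obtain ⟨a, w, hw⟩ : ∃ a, ∃ w : (fromEdgeSet S).Walk a a, w.IsCycle := by
      simpa [IsAcyclic] using hS
    have hwlen : w.length = g := by
      refine le_antisymm ?_ ?_
      · simpa [hdiag, hSg] using hw.isTrail.length_le_ncard_edgeSet
      · exact_mod_cast hg ▸ (egirth_anti hle).trans (egirth_le_length hw)
    obtain ⟨f⟩ := (cycleGraph_isContained_iff (by omega)).mpr ⟨a, w, hw, hwlen⟩
    let c : Copy (cycleGraph g) G := (Copy.ofLE _ _ hle).comp f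
    refine ⟨⟨c.toSubgraph, ⟨c.isoToSubgraph.symm⟩⟩, Subtype.ext ?_⟩
    refine Set.eq_of_subset_of_ncard_le ?_ ?_
    · rintro e he
      induction e with | h x y
      obtain ⟨x, y, hxy, rfl, rfl⟩ := he
      exact hdiag.subset (f.toHom.map_adj hxy)
    · exact (hSg.trans (((Subgraph.ncard_edgeSet_of_iso c.isoToSubgraph.symm).trans
        (ncard_edgeSet_cycleGraph hg3)).symm)).le

/-- Maps which are constant along the edges of `H` factor through the connected components. -/
def connectedComponentLiftEquiv (H : SimpleGraph V) (α : Type*) :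
    {f : V → α // ∀ x y, H.Adj x y → f x = f y} ≃ (H.ConnectedComponent → α) where
  toFun f := Quot.lift f.1 fun x y (h : H.Reachable x y) ↦ by
    obtain ⟨w⟩ := h
    induction w with
    | nil => rfl
    | cons h _ ih => exact (f.2 _ _ h).trans ih
  invFun F := ⟨fun x ↦ F (H.connectedComponentMk x), fun _ _ h ↦
    congrArg F (ConnectedComponent.sound h.reachable)⟩
  left_inv _ := rfl
  right_inv F := funext (ConnectedComponent.ind fun _ ↦ rfl)

/-- Whitney's subgraph expansion of the number of proper colorings. -/
theorem card_coloring_eq_sum_powerset [Fintype V] [Fintype G.edgeSet] (k : ℕ) :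
    (Nat.card (G.Coloring (Fin k)) : ℤ) = ∑ S ∈ G.edgeFinset.powerset,
      (-1) ^ S.card * (k : ℤ) ^ Nat.card (fromEdgeSet (S : Set (Sym2 V))).ConnectedComponent := by
  classical
  have h := Finset.inclusion_exclusion_card_inf_compl G.edgeFinset
    (fun e ↦ {f : V → Fin k | (e.map f).IsDiag})
  have hmem (s : Finset (Sym2 V)) (F : Sym2 V → Finset (V → Fin k)) (f : V → Fin k) :
      f ∈ s.inf F ↔ ∀ e ∈ s, f ∈ F e := by
    simp only [← Finset.singleton_subset_iff, Finset.le_inf_iff]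
  convert h using 2
  · rw [← Nat.card_eq_finsetCard]
    refine Nat.card_congr ⟨fun c ↦ ⟨c, (hmem _ _ _).mpr ?_⟩,
      fun f ↦ Coloring.mk f.1 fun {x y} hxy ↦ ?_, fun _ ↦ rfl, fun _ ↦ rfl⟩
    · refine Sym2.ind fun x y hxy ↦ ?_
      simpa using c.valid (mem_edgeFinset.mp hxy)
    · simpa using (hmem _ _ _).mp f.2 s(x, y) (mem_edgeFinset.mpr hxy)
  · rename_i S hS
    congr 1
    rw [← Nat.card_eq_finsetCard]
    norm_cast
    rw [← Nat.card_fin k, ← Nat.card_fun, Nat.card_fin,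
      ← Nat.card_congr (connectedComponentLiftEquiv _ _)]
    refine Nat.card_congr (Equiv.subtypeEquivRight fun f ↦ ?_)
    rw [hmem]
    constructor
    · intro hf
      refine Sym2.ind fun x y hxy ↦ ?_
      by_cases hne : x = y
      · simp [hne]
      · simpa using hf x y ((fromEdgeSet_adj _).mpr ⟨hxy, hne⟩)
    · intro hf x y hxy
      simpa using hf s(x, y) ((fromEdgeSet_adj _).mp hxy).1

end SimpleGraph

open SimpleGraph

/-- Let `G` be a finite simple graph of order `n`, size `m` and (finite) girth `g`, and write
`π(G,x) = ∑_{i=1}^{n} (-1)^{n-i} h_i x^i`. Then `h_{n-g+1} = C(m, g-1) - η_G(C_g)`, where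
`η_G(C_g)` is the number of subgraphs of `G` isomorphic to the cycle of length `g`. -/
theorem chromatic_coeff_girth_term {V : Type*} [Fintype V]
    (G : SimpleGraph V) (n m g : ℕ)
    (hn : n = Fintype.card V) (hm : m = Nat.card G.edgeSet) (hg : G.egirth = (g : ℕ∞))
    (P : Polynomial ℂ) (hP : IsChromaticPoly G P)
    (h : ℕ → ℂ)
    (hh : P = ∑ i ∈ Finset.Icc 1 n, C ((-1 : ℂ) ^ (n - i)) * C (h i) * X ^ i) :
    h (n - g + 1) = (m.choose (g - 1) : ℂ) - (eta G (SimpleGraph.cycleGraph g) : ℂ) := by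
  classical
  have hg3 : 3 ≤ g := by exact_mod_cast hg ▸ G.three_le_egirth
  have hgn : g ≤ n := by
    have hG : ¬ G.IsAcyclic := fun h ↦ by simp [egirth_eq_top.mpr h] at hg
    obtain ⟨a, w, hw, hlen⟩ := exists_egirth_eq_length.mpr hG
    have h₁ : g = w.length := by exact_mod_cast hg.symm.trans hlen
    have h₂ := hw.support_nodup.length_le_card
    simp only [List.length_tail, Walk.length_support] at h₂
    omega
  have hPsum : P = ∑ S ∈ G.edgeFinset.powerset, C ((-1 : ℂ) ^ S.card) *
      X ^ Nat.card (fromEdgeSet (S : Set (Sym2 V))).ConnectedComponent := by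
    refine Polynomial.eq_of_infinite_eval_eq _ _
      ((Set.infinite_range_of_injective (Nat.cast_injective (R := ℂ))).mono ?_)
    rintro _ ⟨k, rfl⟩
    have := congrArg (Int.cast (R := ℂ)) (G.card_coloring_eq_sum_powerset k)
    simpa [eval_finsetSum, hP k] using this
  have hiff (S : Finset (Sym2 V)) (hS : S ⊆ G.edgeFinset) :
      n - g + 1 = Nat.card (fromEdgeSet (S : Set (Sym2 V))).ConnectedComponent ↔
        S.card = g - 1 ∨ S.card = g ∧ ¬ (fromEdgeSet (S : Set (Sym2 V))).IsAcyclic := by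
    have hle : fromEdgeSet (S : Set (Sym2 V)) ≤ G := by
      simpa using fromEdgeSet_mono (V := V) (Finset.coe_subset.mpr hS)
    have := card_connectedComponent_add_girth_iff hg hle
    rw [edgeSet_fromEdgeSet_of_subset (G := G) (by simpa [← coe_edgeFinset] using hS),
      Set.ncard_coe_finset, Nat.card_eq_fintype_card (α := V), ← hn] at this
    rw [show S.card = g - 1 ↔ S.card + 1 = g by omega, ← this]
    omega
  have hcoeff : P.coeff (n - g + 1) = (-1) ^ (g - 1) * h (n - g + 1) := by
    rw [hh, finsetSum_coeff, Finset.sum_eq_single (n - g + 1)]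
    · rw [← C_mul, coeff_C_mul, coeff_X_pow_self, mul_one]
      congr 2
      omega
    · intro i _ hi
      rw [← C_mul, coeff_C_mul, coeff_X_pow, if_neg hi.symm, mul_zero]
    · intro hi
      exact absurd (Finset.mem_Icc.mpr ⟨by omega, by omega⟩) hi
  have heta : eta G (cycleGraph g) = (G.edgeFinset.powerset.filter fun S : Finset (Sym2 V) ↦
      S.card = g ∧ ¬ (fromEdgeSet (S : Set (Sym2 V))).IsAcyclic).card := by
    rw [eta_cycleGraph_eq_ncard hg, ← Set.ncard_coe_finset,
      ← Set.ncard_image_of_injective _ Finset.coe_injective]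
    congr 1
    ext S
    constructor
    · rintro ⟨h₁, h₂, h₃⟩
      refine ⟨S.toFinset, ?_, by simp⟩
      rw [Finset.mem_coe, Finset.mem_filter, Finset.mem_powerset, ← Set.ncard_eq_toFinset_card',
        Set.coe_toFinset]
      exact ⟨Set.toFinset_subset_toFinset.mpr h₁, h₂, h₃⟩
    · rintro ⟨T, hT, rfl⟩
      simpa [← coe_edgeFinset, Set.ncard_coe_finset] using hT
  have hsum : P.coeff (n - g + 1) =
      (-1) ^ (g - 1) * (m.choose (g - 1) : ℂ) + (-1) ^ g * (eta G (cycleGraph g) : ℂ) := by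
    rw [hPsum, finsetSum_coeff]
    simp only [coeff_C_mul, coeff_X_pow, mul_ite, mul_one, mul_zero]
    rw [← Finset.sum_filter, Finset.filter_congr fun S hS ↦ hiff S (Finset.mem_powerset.mp hS),
      Finset.filter_or, Finset.sum_union, heta, ← Finset.powersetCard_eq_filter]
    · congr 1
      · rw [Finset.sum_congr rfl fun S hS ↦ by rw [(Finset.mem_powersetCard.mp hS).2],
          Finset.sum_const, Finset.card_powersetCard, nsmul_eq_mul, mul_comm, hm,
          Nat.card_eq_fintype_card, edgeFinset_card]
      · rw [Finset.sum_congr rfl fun S hS ↦ by rw [(Finset.mem_filter.mp hS).2.1],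
          Finset.sum_const, nsmul_eq_mul, mul_comm]
    · exact Finset.disjoint_filter.mpr fun S _ h₁ h₂ ↦ by omega
  obtain ⟨k, rfl⟩ : ∃ k, g = k + 1 := ⟨g - 1, by omega⟩
  rw [hcoeff, pow_succ, Nat.add_sub_cancel] at hsum
  refine mul_left_cancel₀ (pow_ne_zero k (neg_ne_zero.mpr one_ne_zero)) (hsum.trans ?_)
  rw [Nat.add_sub_cancel]
  ring
end
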